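/- arXiv:1712.05549 — 2 statements merged into one kernel-verified Lean document; each statement's English description precedes it below -/
import Mathlib

section
/- Let d ≥ 4 be an even integer. There exists a constant C = C(d) > 0 such that the following holds for every finite field F of odd characteristic and every nontrivial additive character e of F. Let g : F^d → ℂ satisfy |g(x)| ≤ 1 for all x and let G ⊆ F^d be its support. Then: (i) if |F|^{(d+2)/2} ≤ |G| ≤ |F|^d then ‖ĝ‖_{L²(P,dσ)} ≤ C |F|^{1/2} |G|^{1/2}; (ii) if |F|^{(3d+2)/6} ≤ |G| ≤ |F|^{(d+2)/2} then ‖ĝ‖_{L²(P,dσ)} ≤ C |F|^{(6-d)/16} |G|^{5/8}; (iii) if 1 ≤ |G| ≤ |F|^{(3d+2)/6} then ‖ĝ‖_{L²(P,dσ)} ≤ C ( |G|^{1/2} + |F|^{(1-d)/4} |G| ). -/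
open Finset

/-- The Fourier transform `ĝ(ξ) = ∑_{x ∈ F^d} g(x) e(−x·ξ)` of `g : F^d → ℂ`, restricted
to the paraboloid `P = {(x̄, x̄·x̄) : x̄ ∈ F^{d-1}} ⊆ F^d` and parameterized by
`ȳ ∈ F^{d-1}` (i.e. evaluated at `ξ = (ȳ, ȳ·ȳ)`). -/
noncomputable def fourierP {F : Type} [Field F] [Fintype F] {d : ℕ} (e : AddChar F ℂ)
    (g : (Fin (d - 1) → F) × F → ℂ) (y : Fin (d - 1) → F) : ℂ :=
  ∑ x : (Fin (d - 1) → F) × F, g x * e (-(∑ i, x.1 i * y i + x.2 * ∑ i, y i * y i))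

/-- `‖ĝ‖_{L²(P,dσ)} = (|F|^{-(d-1)} ∑_{ξ∈P} |ĝ(ξ)|²)^{1/2}`. -/
noncomputable def l2P {F : Type} [Field F] [Fintype F] {d : ℕ} (e : AddChar F ℂ)
    (g : (Fin (d - 1) → F) × F → ℂ) : ℝ :=
  (((Fintype.card F : ℝ) ^ (d - 1))⁻¹ *
    ∑ y : Fin (d - 1) → F, ‖fourierP e g y‖ ^ 2) ^ ((1 : ℝ) / 2)

section FiniteFieldSums

variable {F ι : Type} [Field F] [Fintype F] [Fintype ι]

lemma sum_addChar_mul [DecidableEq F] {e : AddChar F ℂ} (he : e ≠ 1) (u : F) :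
    ∑ s : F, e (s * u) = if u = 0 then (Fintype.card F : ℂ) else 0 := by
  rw [AddChar.sum_mulShift u (AddChar.IsPrimitive.of_ne_one he)]
  split_ifs <;> simp

omit [Fintype F] in
lemma addChar_map_sum (e : AddChar F ℂ) (f : ι → F) : e (∑ i, f i) = ∏ i, e (f i) :=
  map_prod e.toMonoidHom (fun i => Multiplicative.ofAdd (f i)) univ

omit [Fintype F] in
lemma addChar_dotProduct (e : AddChar F ℂ) (x y : ι → F) :
    e (x ⬝ᵥ y) = ∏ i, e (x i * y i) :=
  addChar_map_sum e _

omit [Field F] in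
lemma sum_prod_pi [DecidableEq ι] (f : ι → F → ℂ) :
    ∑ w : ι → F, ∏ i, f i (w i) = ∏ i, ∑ a, f i a :=
  (Fintype.prod_sum f).symm

lemma sum_addChar_dotProduct [DecidableEq F] [DecidableEq ι] {e : AddChar F ℂ} (he : e ≠ 1)
    (u : ι → F) :
    ∑ w : ι → F, e (w ⬝ᵥ u) =
      if u = 0 then (Fintype.card F : ℂ) ^ Fintype.card ι else 0 := by
  simp_rw [addChar_dotProduct]
  rw [sum_prod_pi (fun i a => e (a * u i))]
  simp_rw [sum_addChar_mul he]
  split_ifs with h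
  · simp [h]
  · obtain ⟨i, hi⟩ := Function.ne_iff.mp h
    exact prod_eq_zero (mem_univ i) (if_neg hi)

/-- The quadratic Gauss sum `∑ x, e (u x²)`. -/
noncomputable def quadGauss (e : AddChar F ℂ) (u : F) : ℂ := ∑ x : F, e (u * (x * x))

lemma sum_addChar_quadratic [DecidableEq ι] (e : AddChar F ℂ) (u : F) :
    ∑ w : ι → F, e (u * (w ⬝ᵥ w)) = quadGauss e u ^ Fintype.card ι := by
  have h (w : ι → F) : e (u * (w ⬝ᵥ w)) = ∏ i, e (u * (w i * w i)) := by
    rw [dotProduct, mul_sum, addChar_map_sum]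
  simp_rw [h]
  rw [sum_prod_pi (fun _ a => e (u * (a * a))), prod_const, card_univ, quadGauss]

lemma norm_quadGauss_sq (hF : ringChar F ≠ 2) {e : AddChar F ℂ} (he : e ≠ 1) {u : F}
    (hu : u ≠ 0) : ‖quadGauss e u‖ ^ 2 = Fintype.card F := by
  classical
  have h2 : (2 : F) ≠ 0 := Ring.two_ne_zero hF
  have key : quadGauss e u * (starRingEnd ℂ) (quadGauss e u) = (Fintype.card F : ℂ) := by
    calc quadGauss e u * (starRingEnd ℂ) (quadGauss e u)
        = ∑ y : F, ∑ x : F, e (u * (x * x) - u * (y * y)) := by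
          simp only [quadGauss, map_sum, ← AddChar.map_neg_eq_conj, sum_mul_sum,
            ← AddChar.map_add_eq_mul, sub_eq_add_neg]
          exact sum_comm
      _ = ∑ y : F, ∑ h : F, e (u * (h * h)) * e (y * (2 * u * h)) := by
          refine sum_congr rfl fun y _ => ?_
          rw [← Equiv.sum_comp (Equiv.addRight y)]
          refine sum_congr rfl fun h _ => ?_
          rw [← AddChar.map_add_eq_mul, Equiv.coe_addRight]
          congr 1
          ring
      _ = ∑ h : F, e (u * (h * h)) * ∑ y : F, e (y * (2 * u * h)) := by
          rw [sum_comm]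
          simp_rw [mul_sum]
      _ = Fintype.card F := by
          simp [sum_addChar_mul he, h2, hu]
  rw [Complex.mul_conj, Complex.normSq_eq_norm_sq] at key
  exact_mod_cast key

/-- The quadratic character of `F` with values in `ℂ`. -/
noncomputable def complexQuadraticChar (F : Type) [Field F] [Fintype F] : MulChar F ℂ :=
  open Classical in (quadraticChar F).ringHomComp (Int.castRingHom ℂ)

lemma complexQuadraticChar_sq {u : F} (hu : u ≠ 0) : complexQuadraticChar F u ^ 2 = 1 := by
  classical
  have := quadraticChar_sq_one hu
  simp only [complexQuadraticChar, MulChar.ringHomComp_apply]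
  rw [← map_pow]
  convert congrArg (Int.castRingHom ℂ) this
  simp

lemma sum_comp_sq (hF : ringChar F ≠ 2) (f : F → ℂ) :
    ∑ x : F, f (x * x) = ∑ a : F, (1 + complexQuadraticChar F a) * f a := by
  classical
  rw [← sum_fiberwise_of_maps_to (g := fun x : F => x * x) (t := univ) (by simp)]
  refine sum_congr rfl fun a _ => ?_
  rw [sum_congr rfl (g := fun _ => f a) (by intro x hx; rw [(mem_filter.mp hx).2]), sum_const,
    nsmul_eq_mul]
  congr 1
  have := congrArg (Int.cast : ℤ → ℂ) (quadraticChar_card_sqrts hF a)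
  push_cast at this
  rw [add_comm, complexQuadraticChar, MulChar.ringHomComp_apply]
  convert this using 2
  · congr 2
    ext x
    simp [sq]
  · simp

lemma sum_quadraticChar_mul_addChar (hF : ringChar F ≠ 2) {e : AddChar F ℂ} (he : e ≠ 1) {r : F}
    (hr : r ≠ 0) : ∑ u : F, complexQuadraticChar F u * e (u * r) = quadGauss e r := by
  classical
  have := sum_comp_sq hF (fun x => e (r * x))
  rw [quadGauss, this]
  simp_rw [add_mul, one_mul, sum_add_distrib, mul_comm r]
  rw [sum_addChar_mul he, if_neg hr, zero_add]

lemma sum_quadraticChar_mul_addChar_zero (hF : ringChar F ≠ 2) (e : AddChar F ℂ) :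
    ∑ u : F, complexQuadraticChar F u * e (u * 0) = 0 := by
  classical
  have := congrArg (Int.cast : ℤ → ℂ) (quadraticChar_sum_zero hF)
  push_cast at this
  simpa [complexQuadraticChar] using this

lemma norm_sum_quadraticChar_mul_addChar_le (hF : ringChar F ≠ 2) {e : AddChar F ℂ} (he : e ≠ 1)
    (r : F) : ‖∑ u : F, complexQuadraticChar F u * e (u * r)‖ ≤ √(Fintype.card F) := by
  rcases eq_or_ne r 0 with rfl | hr
  · rw [sum_quadraticChar_mul_addChar_zero hF]
    simp
  · rw [sum_quadraticChar_mul_addChar hF he hr]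
    exact Real.le_sqrt_of_sq_le (norm_quadGauss_sq hF he hr).le

lemma quadGauss_eq (hF : ringChar F ≠ 2) {e : AddChar F ℂ} (he : e ≠ 1) {u : F} (hu : u ≠ 0) :
    quadGauss e u = complexQuadraticChar F u * quadGauss e 1 := by
  rw [← sum_quadraticChar_mul_addChar hF he hu, ← sum_quadraticChar_mul_addChar hF he one_ne_zero,
    mul_sum]
  refine Fintype.sum_equiv (Equiv.mulRight₀ u hu) _ _ fun x => ?_
  have := complexQuadraticChar_sq hu
  rw [Equiv.mulRight₀_apply, map_mul (complexQuadraticChar F), mul_one]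
  linear_combination (-(complexQuadraticChar F x) * e (x * u)) * this

lemma sum_addChar_completeSquare [DecidableEq ι] (hF : ringChar F ≠ 2) (e : AddChar F ℂ) {t : F}
    (ht : t ≠ 0) (z : ι → F) :
    ∑ w : ι → F, e (t * (w ⬝ᵥ w) + w ⬝ᵥ z) =
      e (-(4 * t)⁻¹ * (z ⬝ᵥ z)) * quadGauss e t ^ Fintype.card ι := by
  have h2 : (2 : F) ≠ 0 := Ring.two_ne_zero hF
  have h4 : (4 : F) ≠ 0 := by
    have : (4 : F) = 2 * 2 := by norm_num
    rw [this]
    exact mul_ne_zero h2 h2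
  rw [← sum_addChar_quadratic, mul_sum, ← Equiv.sum_comp (Equiv.subRight ((2 * t)⁻¹ • z))]
  refine sum_congr rfl fun w _ => ?_
  rw [← AddChar.map_add_eq_mul, Equiv.subRight_apply]
  congr 1
  simp only [sub_dotProduct, dotProduct_sub, smul_dotProduct, dotProduct_smul, smul_eq_mul,
    dotProduct_comm z w]
  field_simp
  ring

end FiniteFieldSums

section Counting

variable {F ι : Type} [Field F] [Fintype F] [Fintype ι]

/-- Expanding the square in an `L²` sum of a linear combination of functions. -/
lemma sum_norm_sq_expand {X Y : Type} [Fintype Y] (E : Finset X) (h : X → ℂ) (φ : X → Y → ℂ) :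
    ((∑ w, ‖∑ x ∈ E, h x * φ x w‖ ^ 2 : ℝ) : ℂ) =
      ∑ x ∈ E, ∑ y ∈ E, h x * (starRingEnd ℂ) (h y) *
        ∑ w, φ x w * (starRingEnd ℂ) (φ y w) := by
  push_cast
  simp_rw [← Complex.mul_conj', map_sum, map_mul, sum_mul_sum, mul_sum]
  rw [sum_comm]
  refine sum_congr rfl fun x _ => ?_
  rw [sum_comm]
  refine sum_congr rfl fun y _ => sum_congr rfl fun w _ => ?_
  ring

lemma sum_norm_sq_of_orthogonal {X Y : Type} [Fintype Y] [DecidableEq X] (E : Finset X)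
    (h : X → ℂ) (φ : X → Y → ℂ) (N : ℝ)
    (hφ : ∀ x y, ∑ w, φ x w * (starRingEnd ℂ) (φ y w) = if x = y then (N : ℂ) else 0) :
    ∑ w, ‖∑ x ∈ E, h x * φ x w‖ ^ 2 = N * ∑ x ∈ E, ‖h x‖ ^ 2 := by
  have key := sum_norm_sq_expand E h φ
  simp_rw [hφ, mul_ite, mul_zero, sum_ite_eq] at key
  rw [sum_congr rfl (g := fun x => ((N * ‖h x‖ ^ 2 : ℝ) : ℂ))] at key
  · rw [← Complex.ofReal_sum] at key
    rw [mul_sum]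
    exact_mod_cast key
  · intro x hx
    rw [if_pos hx, Complex.mul_conj']
    push_cast
    ring

lemma sum_norm_sq_sum_addChar [DecidableEq F] [DecidableEq ι] {e : AddChar F ℂ} (he : e ≠ 1)
    (E : Finset (ι → F)) :
    ∑ w : ι → F, ‖∑ x ∈ E, e (w ⬝ᵥ x)‖ ^ 2 = (Fintype.card F : ℝ) ^ Fintype.card ι * #E := by
  have := sum_norm_sq_of_orthogonal E (fun _ => (1 : ℂ)) (fun x w : ι → F => e (w ⬝ᵥ x))
    ((Fintype.card F : ℝ) ^ Fintype.card ι) ?_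
  · simpa using this
  · intro x y
    simp_rw [← AddChar.map_neg_eq_conj, ← AddChar.map_add_eq_mul, ← sub_eq_add_neg,
      ← dotProduct_sub]
    rw [sum_addChar_dotProduct he]
    simp [sub_eq_zero]

lemma card_isotropic_pairs_le [DecidableEq F] [DecidableEq ι] (hF : ringChar F ≠ 2)
    {e : AddChar F ℂ} (he : e ≠ 1) {k : ℕ} (hk : Fintype.card ι = 2 * k + 1)
    (E : Finset (ι → F)) :
    (#{p ∈ E ×ˢ E | (p.1 - p.2) ⬝ᵥ (p.1 - p.2) = 0} : ℝ) ≤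
      (#E : ℝ) ^ 2 / Fintype.card F + (Fintype.card F : ℝ) ^ k * #E := by
  set q : ℝ := (Fintype.card F : ℝ) with hq
  have hq0 : 0 < q := Nat.cast_pos.mpr Fintype.card_pos
  have h2 : (2 : F) ≠ 0 := Ring.two_ne_zero hF
  have h4 : (4 : F) ≠ 0 := by
    have : (4 : F) = 2 * 2 := by norm_num
    rw [this]
    exact mul_ne_zero h2 h2
  set I : ℝ := (#{p ∈ E ×ˢ E | (p.1 - p.2) ⬝ᵥ (p.1 - p.2) = 0} : ℝ) with hI
  let S : F → ℂ := fun s => ∑ p ∈ E ×ˢ E, e (s * ((p.1 - p.2) ⬝ᵥ (p.1 - p.2)))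
  have hS0 : S 0 = (#E : ℂ) ^ 2 := by
    simp [S, card_product, sq]
  have hSI : ∑ s, S s = (q : ℂ) * I := by
    simp only [S]
    rw [sum_comm]
    simp_rw [sum_addChar_mul he]
    rw [← sum_filter, sum_const, hI, nsmul_eq_mul, mul_comm, hq]
    push_cast
    rfl
  have hstep (u : F) (hu : u ≠ 0) :
      quadGauss e 1 ^ Fintype.card ι * S (-(4 * u)⁻¹) =
        ∑ w : ι → F, (‖∑ x ∈ E, e (w ⬝ᵥ x)‖ ^ 2 : ℝ) * (complexQuadraticChar F u *
          e (u * (w ⬝ᵥ w))) := by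
    have hχ : quadGauss e 1 ^ Fintype.card ι =
        complexQuadraticChar F u * quadGauss e u ^ Fintype.card ι := by
      have h1 := complexQuadraticChar_sq hu
      rw [quadGauss_eq hF he hu, mul_pow, ← mul_assoc, ← pow_succ', hk,
        show 2 * k + 1 + 1 = 2 * (k + 1) by ring, pow_mul (complexQuadraticChar F u), h1, one_pow,
        one_mul]
    have h3 : quadGauss e u ^ Fintype.card ι * S (-(4 * u)⁻¹) =
        ∑ w : ι → F, (‖∑ x ∈ E, e (w ⬝ᵥ x)‖ ^ 2 : ℝ) * e (u * (w ⬝ᵥ w)) := by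
      simp only [S]
      rw [mul_sum]
      simp_rw [mul_comm (quadGauss e u ^ Fintype.card ι),
        ← sum_addChar_completeSquare hF e hu]
      rw [sum_comm]
      refine sum_congr rfl fun w _ => ?_
      push_cast
      rw [← Complex.mul_conj', map_sum, sum_mul_sum, ← sum_product', sum_mul]
      refine sum_congr rfl fun p _ => ?_
      rw [← AddChar.map_neg_eq_conj, ← AddChar.map_add_eq_mul, ← AddChar.map_add_eq_mul,
        dotProduct_sub]
      congr 1
      ring
    rw [hχ, mul_assoc, h3, mul_sum]
    refine sum_congr rfl fun w _ => ?_
    ring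
  have hreidx : ∑ u ∈ univ.erase (0 : F), S (-(4 * u)⁻¹) = ∑ s ∈ univ.erase (0 : F), S s := by
    refine sum_nbij' (fun u => -(4 * u)⁻¹) (fun u => -(4 * u)⁻¹) ?_ ?_ ?_ ?_ ?_
    · intro u hu
      simpa [h4] using hu
    · intro u hu
      simpa [h4] using hu
    · intro u hu
      have hu' : u ≠ 0 := by simpa using hu
      field_simp
    · intro u hu
      have hu' : u ≠ 0 := by simpa using hu
      field_simp
    · intro u _
      rfl
  have hsum : quadGauss e 1 ^ Fintype.card ι * ∑ s ∈ univ.erase (0 : F), S s =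
      ∑ w : ι → F, (‖∑ x ∈ E, e (w ⬝ᵥ x)‖ ^ 2 : ℝ) *
        ∑ u : F, complexQuadraticChar F u * e (u * (w ⬝ᵥ w)) := by
    rw [← hreidx, mul_sum, sum_congr rfl (fun u hu => hstep u (ne_of_mem_erase hu)), sum_comm]
    refine sum_congr rfl fun w _ => ?_
    rw [← mul_sum]
    congr 1
    exact sum_erase _ (by rw [MulChar.map_zero, zero_mul])
  have hnorm := norm_quadGauss_sq hF he (one_ne_zero (α := F))
  have hg : ‖quadGauss e 1‖ = √q := by
    rw [hq, ← hnorm, Real.sqrt_sq (norm_nonneg _)]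
  have hR : ‖∑ s ∈ univ.erase (0 : F), S s‖ ≤ q * (q ^ k * #E) := by
    have h5 : √q ^ Fintype.card ι * ‖∑ s ∈ univ.erase (0 : F), S s‖ ≤
        √q * (q ^ Fintype.card ι * #E) := by
      rw [← hg, ← norm_pow, ← norm_mul, hsum, ← sum_norm_sq_sum_addChar he, mul_sum]
      refine (norm_sum_le _ _).trans (sum_le_sum fun w _ => ?_)
      rw [norm_mul, Complex.norm_real, Real.norm_of_nonneg (by positivity), mul_comm, hg]
      gcongr
      exact norm_sum_quadraticChar_mul_addChar_le hF he _
    have h6 : √q ^ Fintype.card ι = √q * q ^ k := by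
      rw [hk, pow_succ', pow_mul, Real.sq_sqrt hq0.le]
    have h7 : q ^ Fintype.card ι = q ^ k * q * q ^ k := by
      rw [hk]; ring
    rw [h6, h7] at h5
    have h8 : 0 < √q * q ^ k := by positivity
    refine le_of_mul_le_mul_left (h5.trans_eq ?_) h8
    ring
  have hfin : q * I ≤ (#E : ℝ) ^ 2 + q * (q ^ k * #E) := by
    have h9 : ((q * I - (#E : ℝ) ^ 2 : ℝ) : ℂ) = ∑ s ∈ univ.erase (0 : F), S s := by
      push_cast
      rw [← hSI, ← hS0, ← add_sum_erase _ _ (mem_univ (0 : F))]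
      ring
    rw [← h9, Complex.norm_real] at hR
    linarith [le_abs_self (q * I - (#E : ℝ) ^ 2), Real.norm_eq_abs (q * I - (#E : ℝ) ^ 2)]
  rw [← mul_le_mul_iff_right₀ hq0, mul_add, mul_div_cancel₀ _ hq0.ne']
  exact hfin

lemma card_hyperplane [DecidableEq F] [DecidableEq ι] {e : AddChar F ℂ} (he : e ≠ 1)
    {v : ι → F} (hv : v ≠ 0) (α : F) :
    (#{b : ι → F | v ⬝ᵥ b = α} : ℝ) * Fintype.card F =
      (Fintype.card F : ℝ) ^ Fintype.card ι := by
  have key : (#{b : ι → F | v ⬝ᵥ b = α} : ℂ) * Fintype.card F =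
      (Fintype.card F : ℂ) ^ Fintype.card ι := by
    calc (#{b : ι → F | v ⬝ᵥ b = α} : ℂ) * Fintype.card F
        = ∑ b : ι → F, ∑ s : F, e (s * (v ⬝ᵥ b - α)) := by
          simp_rw [sum_addChar_mul he, sub_eq_zero]
          rw [← sum_filter, sum_const, nsmul_eq_mul]
      _ = ∑ s : F, e (-(s * α)) * ∑ b : ι → F, e (b ⬝ᵥ (s • v)) := by
          rw [sum_comm]
          simp_rw [mul_sum, ← AddChar.map_add_eq_mul, dotProduct_smul, smul_eq_mul,
            dotProduct_comm v]
          refine sum_congr rfl fun s _ => sum_congr rfl fun b _ => congrArg e ?_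
          ring
      _ = _ := by
          simp_rw [sum_addChar_dotProduct he, smul_eq_zero_iff_left hv]
          simp
  exact_mod_cast key

lemma card_inter_hyperplanes [DecidableEq F] [DecidableEq ι] {e : AddChar F ℂ} (he : e ≠ 1)
    {v v' : ι → F} (hv : ∀ s s' : F, s • v + s' • v' = 0 → s = 0 ∧ s' = 0) (α α' : F) :
    (#{b : ι → F | v ⬝ᵥ b = α ∧ v' ⬝ᵥ b = α'} : ℝ) * (Fintype.card F : ℝ) ^ 2 =
      (Fintype.card F : ℝ) ^ Fintype.card ι := by
  have hite (s s' : F) : (s • v + s' • v' = 0) = (s = 0 ∧ s' = 0) :=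
    propext ⟨hv s s', by rintro ⟨rfl, rfl⟩; simp⟩
  have key : (#{b : ι → F | v ⬝ᵥ b = α ∧ v' ⬝ᵥ b = α'} : ℂ) * (Fintype.card F : ℂ) ^ 2 =
      (Fintype.card F : ℂ) ^ Fintype.card ι := by
    calc (#{b : ι → F | v ⬝ᵥ b = α ∧ v' ⬝ᵥ b = α'} : ℂ) * (Fintype.card F : ℂ) ^ 2
        = ∑ b : ι → F, (∑ s : F, e (s * (v ⬝ᵥ b - α))) * ∑ s : F, e (s * (v' ⬝ᵥ b - α')) := by
          simp_rw [sum_addChar_mul he, sub_eq_zero, ite_zero_mul_ite_zero]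
          rw [← sum_filter, sum_const, nsmul_eq_mul, sq]
      _ = ∑ s : F, ∑ s' : F, e (-(s * α + s' * α')) *
            ∑ b : ι → F, e (b ⬝ᵥ (s • v + s' • v')) := by
          simp_rw [sum_mul_sum]
          rw [sum_comm]
          refine sum_congr rfl fun s _ => ?_
          rw [sum_comm]
          refine sum_congr rfl fun s' _ => ?_
          rw [mul_sum]
          refine sum_congr rfl fun b _ => ?_
          rw [← AddChar.map_add_eq_mul, ← AddChar.map_add_eq_mul]
          congr 1
          simp only [dotProduct_add, dotProduct_smul, smul_eq_mul, dotProduct_comm _ b]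
          ring
      _ = _ := by
          simp_rw [sum_addChar_dotProduct he, hite, ite_and]
          simp
  exact_mod_cast key

end Counting

section Energy

variable {F ι : Type} [Field F] [Fintype F] [Fintype ι] [DecidableEq F] [DecidableEq ι]

lemma card_common_right_angles_le {e : AddChar F ℂ} (he : e ≠ 1) {a c c' : ι → F}
    (hc : (c - a) ⬝ᵥ (c - a) ≠ 0) (hc' : (c' - a) ⬝ᵥ (c' - a) ≠ 0) (hne : c ≠ c') :
    (#{b : ι → F | (c - a) ⬝ᵥ b = (c - a) ⬝ᵥ c ∧ (c' - a) ⬝ᵥ b = (c' - a) ⬝ᵥ c'} : ℝ) ≤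
      (Fintype.card F : ℝ) ^ Fintype.card ι / (Fintype.card F : ℝ) ^ 2 := by
  have hq0 : (0 : ℝ) < Fintype.card F := Nat.cast_pos.mpr Fintype.card_pos
  by_cases hind : ∀ s s' : F, s • (c - a) + s' • (c' - a) = 0 → s = 0 ∧ s' = 0
  · rw [le_div_iff₀ (by positivity)]
    exact (card_inter_hyperplanes he hind _ _).le
  · have hempty : #{b : ι → F | (c - a) ⬝ᵥ b = (c - a) ⬝ᵥ c ∧
        (c' - a) ⬝ᵥ b = (c' - a) ⬝ᵥ c'} = 0 := by
      rw [card_eq_zero, filter_eq_empty_iff]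
      rintro b - ⟨h1, h2⟩
      refine hind fun s s' hs => ?_
      by_contra hss
      set v := c - a with hv
      set v' := c' - a with hv'
      have hb1 : v ⬝ᵥ (b - a) = v ⬝ᵥ v := by
        rw [hv, dotProduct_sub, h1, ← dotProduct_sub]
      have hb2 : v' ⬝ᵥ (b - a) = v' ⬝ᵥ v' := by
        rw [hv', dotProduct_sub, h2, ← dotProduct_sub]
      have hlin : s * (v ⬝ᵥ v) + s' * (v' ⬝ᵥ v') = 0 := by
        have := congrArg (· ⬝ᵥ (b - a)) hs
        simpa only [add_dotProduct, smul_dotProduct, zero_dotProduct, smul_eq_mul, hb1, hb2]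
          using this
      have hvv : s • v = -(s' • v') := eq_neg_of_add_eq_zero_left hs
      have hquad : s * s * (v ⬝ᵥ v) = s' * s' * (v' ⬝ᵥ v') := by
        have := congrArg (fun x => x ⬝ᵥ x) hvv
        simp only [smul_dotProduct, dotProduct_smul, neg_dotProduct, dotProduct_neg, smul_eq_mul]
          at this
        linear_combination this
      have hs0 : s ≠ 0 := by
        rintro rfl
        apply hss
        simpa [hc'] using hlin
      have hs'0 : s' ≠ 0 := by
        rintro rfl
        apply hss
        simpa [hc] using hlin
      have hsum : s' = -s := by
        have h3 : s' * (v' ⬝ᵥ v') * (s' + s) = 0 := by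
          linear_combination s * hlin - hquad
        have := (mul_eq_zero.mp h3).resolve_left (mul_ne_zero hs'0 hc')
        linear_combination this
      have h4 : s • (v - v') = 0 := by
        rw [smul_sub, hvv, hsum]
        simp
      have h5 := (smul_eq_zero.mp h4).resolve_left hs0
      apply hne
      have : c - c' = v - v' := by simp [hv, hv']
      rw [← sub_eq_zero, this, h5]
    rw [hempty, Nat.cast_zero]
    positivity

lemma card_right_angles_anisotropic_le {e : AddChar F ℂ} (he : e ≠ 1) {k : ℕ}
    (hk : Fintype.card ι = 2 * k + 1) (E : Finset (ι → F)) (a : ι → F) :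
    (#{p ∈ E ×ˢ E | (p.2 - a) ⬝ᵥ (p.2 - a) ≠ 0 ∧ (p.2 - a) ⬝ᵥ (p.1 - p.2) = 0} : ℝ) ≤
      (#E : ℝ) ^ 2 / Fintype.card F + (Fintype.card F : ℝ) ^ k * #E := by
  set q : ℝ := (Fintype.card F : ℝ) with hq
  have hq0 : 0 < q := Nat.cast_pos.mpr Fintype.card_pos
  set A : Finset (ι → F) := {c ∈ E | (c - a) ⬝ᵥ (c - a) ≠ 0} with hA
  have hAE : (#A : ℝ) ≤ #E := by exact_mod_cast card_filter_le _ _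
  let r : (ι → F) → ℝ := fun b => ∑ c ∈ A, if (c - a) ⬝ᵥ b = (c - a) ⬝ᵥ c then 1 else 0
  have hcard : (#{p ∈ E ×ˢ E | (p.2 - a) ⬝ᵥ (p.2 - a) ≠ 0 ∧
      (p.2 - a) ⬝ᵥ (p.1 - p.2) = 0} : ℝ) = ∑ b ∈ E, r b := by
    rw [card_filter, Nat.cast_sum, sum_product]
    refine sum_congr rfl fun b _ => ?_
    simp only [r, hA]
    rw [sum_filter]
    refine sum_congr rfl fun c _ => ?_
    simp only [dotProduct_sub (c - a) b c, sub_eq_zero, ite_and]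
    push_cast
    rfl
  set N : ℝ := q ^ Fintype.card ι with hN
  have hN0 : 0 < N := by positivity
  have hr1 : ∑ b, r b = #A * (N / q) := by
    simp only [r]
    rw [sum_comm, ← nsmul_eq_mul]
    refine sum_eq_card_nsmul fun c hc => ?_
    rw [sum_boole, eq_div_iff hq0.ne']
    refine card_hyperplane he ?_ _
    intro h0
    exact (mem_filter.mp hc).2 (by simp [h0])
  have hr2 : ∑ b, r b ^ 2 ≤ #A * (N / q) + (#A : ℝ) ^ 2 * (N / q ^ 2) := by
    have hexp : ∑ b, r b ^ 2 = ∑ c ∈ A, ∑ c' ∈ A,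
        (#{b : ι → F | (c - a) ⬝ᵥ b = (c - a) ⬝ᵥ c ∧ (c' - a) ⬝ᵥ b = (c' - a) ⬝ᵥ c'} : ℝ) := by
      simp_rw [sq, r, sum_mul_sum, ite_zero_mul_ite_zero, one_mul]
      rw [sum_comm]
      refine sum_congr rfl fun c _ => ?_
      rw [sum_comm]
      refine sum_congr rfl fun c' _ => ?_
      rw [sum_boole]
    have hbound : ∀ c ∈ A, ∀ c' ∈ A,
        (#{b : ι → F | (c - a) ⬝ᵥ b = (c - a) ⬝ᵥ c ∧ (c' - a) ⬝ᵥ b = (c' - a) ⬝ᵥ c'} : ℝ) ≤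
          (if c = c' then N / q else 0) + N / q ^ 2 := by
      intro c hc c' hc'
      split_ifs with h
      · subst h
        have h0 : c - a ≠ 0 := fun h0 => (mem_filter.mp hc).2 (by simp [h0])
        have := card_hyperplane he h0 ((c - a) ⬝ᵥ c)
        rw [← eq_div_iff hq0.ne'] at this
        simp only [and_self]
        rw [this]
        have : 0 ≤ N / q ^ 2 := by positivity
        linarith
      · rw [zero_add]
        exact card_common_right_angles_le he (mem_filter.mp hc).2 (mem_filter.mp hc').2 h
    rw [hexp]
    refine (sum_le_sum fun c hc => sum_le_sum fun c' hc' => hbound c hc c' hc').trans_eq ?_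
    have : ∀ c ∈ A, ∑ c' ∈ A, ((if c = c' then N / q else 0) + N / q ^ 2) =
        N / q + #A * (N / q ^ 2) := by
      intro c hc
      rw [sum_add_distrib, sum_ite_eq, if_pos hc, sum_const, nsmul_eq_mul]
    rw [sum_congr rfl this, sum_const, nsmul_eq_mul]
    ring
  have hvar : ∑ b, (r b - #A / q) ^ 2 ≤ #A * (N / q) := by
    have hV : (Fintype.card (ι → F) : ℝ) = N := by simp [hN, hq]
    have : ∑ b, (r b - #A / q) ^ 2 =
        ∑ b, r b ^ 2 - 2 * (#A / q) * ∑ b, r b + N * (#A / q) ^ 2 := by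
      simp_rw [sub_sq, sum_add_distrib, sum_sub_distrib, sum_const, card_univ, nsmul_eq_mul, hV,
        mul_sum]
      congr 2
      exact sum_congr rfl fun b _ => by ring
    rw [this, hr1]
    have h1 : 2 * (#A / q) * (#A * (N / q)) = 2 * ((#A : ℝ) ^ 2 * (N / q ^ 2)) := by
      field_simp
    have h2 : N * (#A / q) ^ 2 = (#A : ℝ) ^ 2 * (N / q ^ 2) := by
      field_simp
    rw [h1, h2]
    linarith
  have hNq : N / q = (q ^ k) ^ 2 := by
    rw [hN, hk, pow_succ, mul_div_cancel_right₀ _ hq0.ne', ← pow_mul, mul_comm]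
  have hdev : ∑ b ∈ E, (r b - #A / q) ≤ q ^ k * #E := by
    refine le_of_sq_le_sq ?_ (by positivity)
    calc (∑ b ∈ E, (r b - #A / q)) ^ 2 ≤ #E * ∑ b ∈ E, (r b - #A / q) ^ 2 :=
          sq_sum_le_card_mul_sum_sq
      _ ≤ #E * ∑ b, (r b - #A / q) ^ 2 := by
          gcongr
          exact subset_univ E
      _ ≤ #E * (#E * (N / q)) := by
          gcongr
          exact hvar.trans (by gcongr)
      _ = (q ^ k * #E) ^ 2 := by
          rw [hNq]; ring
  rw [hcard]
  rw [sum_sub_distrib, sum_const, nsmul_eq_mul] at hdev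
  have : (#E : ℝ) * (#A / q) ≤ (#E : ℝ) ^ 2 / q := by
    rw [mul_div_assoc', sq]
    gcongr
  linarith

/-- The additive energy of the lift of `E` to the paraboloid. -/
def parabEnergy (E : Finset (ι → F)) : ℕ :=
  #{p ∈ (E ×ˢ E) ×ˢ (E ×ˢ E) | p.1.1 + p.1.2 = p.2.1 + p.2.2 ∧
    p.1.1 ⬝ᵥ p.1.1 + p.1.2 ⬝ᵥ p.1.2 = p.2.1 ⬝ᵥ p.2.1 + p.2.2 ⬝ᵥ p.2.2}

omit [Fintype F] [DecidableEq ι] in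
lemma parabEnergy_le_card_right_angles (h2 : (2 : F) ≠ 0) (E : Finset (ι → F)) :
    parabEnergy E ≤ #{p ∈ E ×ˢ (E ×ˢ E) | (p.2.2 - p.1) ⬝ᵥ (p.2.1 - p.2.2) = 0} := by
  refine card_le_card_of_injOn (fun p => (p.1.1, p.1.2, p.2.1)) ?_ ?_
  · rintro ⟨⟨a, b⟩, c, c'⟩ hp
    simp only [coe_filter, Set.mem_ofPred_eq, mem_product] at hp ⊢
    obtain ⟨⟨⟨ha, hb⟩, hc, hc'⟩, hadd, hsq⟩ := hp
    refine ⟨⟨ha, hb, hc⟩, ?_⟩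
    obtain rfl : c' = a + b - c := by rw [hadd]; abel
    simp only [add_dotProduct, dotProduct_add, sub_dotProduct, dotProduct_sub] at hsq ⊢
    rw [dotProduct_comm b a, dotProduct_comm c a, dotProduct_comm c b] at *
    apply mul_left_cancel₀ h2
    linear_combination hsq
  · rintro ⟨⟨a, b⟩, c, c'⟩ hp ⟨⟨a₁, b₁⟩, c₁, c₁'⟩ hp₁ h
    simp only [Prod.mk.injEq] at h
    obtain ⟨rfl, rfl, rfl⟩ := h
    simp only [coe_filter, Set.mem_ofPred_eq] at hp hp₁
    have : c + c' = c + c₁' := hp.2.1.symm.trans hp₁.2.1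
    rw [add_left_cancel this]

/-- The additive energy estimate on the paraboloid over an odd-dimensional base. -/
lemma parabEnergy_le (hF : ringChar F ≠ 2) {e : AddChar F ℂ} (he : e ≠ 1) {k : ℕ}
    (hk : Fintype.card ι = 2 * k + 1) (E : Finset (ι → F)) :
    (parabEnergy E : ℝ) ≤
      2 * ((#E : ℝ) ^ 3 / Fintype.card F + (Fintype.card F : ℝ) ^ k * (#E : ℝ) ^ 2) := by
  have hsplit : #{p ∈ E ×ˢ (E ×ˢ E) | (p.2.2 - p.1) ⬝ᵥ (p.2.1 - p.2.2) = 0} ≤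
      ∑ a ∈ E, #{p ∈ E ×ˢ E | (p.2 - a) ⬝ᵥ (p.2 - a) ≠ 0 ∧ (p.2 - a) ⬝ᵥ (p.1 - p.2) = 0} +
        #E * #{p ∈ E ×ˢ E | (p.1 - p.2) ⬝ᵥ (p.1 - p.2) = 0} := by
    have h1 : #E * #{p ∈ E ×ˢ E | (p.1 - p.2) ⬝ᵥ (p.1 - p.2) = 0} =
        ∑ a ∈ E, ∑ b ∈ E, ∑ c ∈ E, if (c - a) ⬝ᵥ (c - a) = 0 then 1 else 0 := by
      rw [sum_comm, card_filter, sum_product_right, ← smul_eq_mul, ← sum_const]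
    rw [h1, ← sum_add_distrib, card_filter, sum_product]
    refine sum_le_sum fun a _ => ?_
    rw [card_filter, ← sum_product', ← sum_add_distrib]
    refine sum_le_sum fun p _ => ?_
    by_cases h3 : (p.2 - a) ⬝ᵥ (p.2 - a) = 0 <;>
      by_cases h4 : (p.2 - a) ⬝ᵥ (p.1 - p.2) = 0 <;>
        simp [h3, h4, -dotProduct_sub, -sub_dotProduct]
  have h := (parabEnergy_le_card_right_angles (Ring.two_ne_zero hF) E).trans hsplit
  have h' : (parabEnergy E : ℝ) ≤
      ∑ a ∈ E, (#{p ∈ E ×ˢ E | (p.2 - a) ⬝ᵥ (p.2 - a) ≠ 0 ∧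
        (p.2 - a) ⬝ᵥ (p.1 - p.2) = 0} : ℝ) +
        #E * (#{p ∈ E ×ˢ E | (p.1 - p.2) ⬝ᵥ (p.1 - p.2) = 0} : ℝ) := by
    exact_mod_cast h
  refine h'.trans ((add_le_add
    (sum_le_sum fun a _ => card_right_angles_anisotropic_le he hk E a)
    (mul_le_mul_of_nonneg_left (card_isotropic_pairs_le hF he hk E) (by positivity))).trans_eq ?_)
  rw [sum_const, nsmul_eq_mul]
  ring

end Energy

section Restriction

variable {F ι : Type} [Field F] [Fintype F] [Fintype ι] [DecidableEq F] [DecidableEq ι]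

lemma sum_addChar_prod {e : AddChar F ℂ} (he : e ≠ 1) (u : ι → F) (t : F) :
    ∑ w : (ι → F) × F, e (w.1 ⬝ᵥ u + w.2 * t) =
      if u = 0 ∧ t = 0 then (Fintype.card F : ℂ) ^ (Fintype.card ι + 1) else 0 := by
  simp_rw [AddChar.map_add_eq_mul]
  rw [Fintype.sum_prod_type]
  simp_rw [← mul_sum, ← sum_mul]
  rw [sum_addChar_dotProduct he, sum_addChar_mul he, ite_zero_mul_ite_zero, pow_succ]

/-- The `L⁴` norm of the extension operator is controlled by the additive energy. -/
lemma sum_norm_extension_pow_four_le {e : AddChar F ℂ} (he : e ≠ 1) (H : Finset (ι → F))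
    (h : (ι → F) → ℂ) (hh : ∀ y, ‖h y‖ ≤ 1) :
    ∑ w : (ι → F) × F, ‖∑ y ∈ H, h y * e (w.2 * (y ⬝ᵥ y) + w.1 ⬝ᵥ y)‖ ^ 4 ≤
      (Fintype.card F : ℝ) ^ (Fintype.card ι + 1) * parabEnergy H := by
  let φ : (ι → F) × (ι → F) → (ι → F) × F → ℂ := fun p w =>
    e (w.2 * (p.1 ⬝ᵥ p.1) + w.1 ⬝ᵥ p.1) * e (w.2 * (p.2 ⬝ᵥ p.2) + w.1 ⬝ᵥ p.2)
  have hφ (p p' : (ι → F) × (ι → F)) : ∑ w, φ p w * (starRingEnd ℂ) (φ p' w) =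
      if p.1 + p.2 = p'.1 + p'.2 ∧
        p.1 ⬝ᵥ p.1 + p.2 ⬝ᵥ p.2 = p'.1 ⬝ᵥ p'.1 + p'.2 ⬝ᵥ p'.2
      then (Fintype.card F : ℂ) ^ (Fintype.card ι + 1) else 0 := by
    have := sum_addChar_prod he (p.1 + p.2 - (p'.1 + p'.2))
      (p.1 ⬝ᵥ p.1 + p.2 ⬝ᵥ p.2 - (p'.1 ⬝ᵥ p'.1 + p'.2 ⬝ᵥ p'.2))
    simp only [sub_eq_zero] at this
    rw [← this]
    refine sum_congr rfl fun w _ => ?_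
    simp only [φ, ← AddChar.map_neg_eq_conj, ← AddChar.map_add_eq_mul, dotProduct_sub,
      dotProduct_add]
    congr 1
    ring
  have hsq (w : (ι → F) × F) : ‖∑ y ∈ H, h y * e (w.2 * (y ⬝ᵥ y) + w.1 ⬝ᵥ y)‖ ^ 4 =
      ‖∑ p ∈ H ×ˢ H, (h p.1 * h p.2) * φ p w‖ ^ 2 := by
    rw [show 4 = 2 * 2 from rfl, pow_mul, ← norm_pow, sq (∑ y ∈ H, _), sum_mul_sum, ← sum_product']
    congr 2
    refine sum_congr rfl fun p _ => ?_
    simp only [φ]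
    ring
  simp_rw [hsq]
  rw [← Complex.norm_of_nonneg (r := ∑ w, ‖∑ p ∈ H ×ˢ H, (h p.1 * h p.2) * φ p w‖ ^ 2)
    (by positivity), sum_norm_sq_expand, ← sum_product']
  simp_rw [hφ]
  refine (norm_sum_le _ _).trans ?_
  rw [parabEnergy, mul_comm, ← nsmul_eq_mul, ← sum_const, sum_filter]
  refine sum_le_sum fun p _ => ?_
  split_ifs
  · rw [norm_mul, norm_pow, Complex.norm_natCast]
    refine mul_le_of_le_one_left (by positivity) ?_
    rw [norm_mul, norm_mul, RCLike.norm_conj, norm_mul]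
    have := mul_le_one₀ (hh p.1.1) (norm_nonneg _) (hh p.1.2)
    exact mul_le_one₀ this (by positivity) (mul_le_one₀ (hh p.2.1) (norm_nonneg _) (hh p.2.2))
  · simp

/-- The character `e (-x·ξ)` at the point `ξ = (y, y·y)` of the paraboloid. -/
noncomputable def parabChar (e : AddChar F ℂ) (x : (ι → F) × F) (y : ι → F) : ℂ :=
  e (-(x.1 ⬝ᵥ y + x.2 * (y ⬝ᵥ y)))

/-- The Fourier transform of the counting measure on the paraboloid, at `x - x'`. -/
noncomputable def parabKernel (e : AddChar F ℂ) (x x' : (ι → F) × F) : ℂ :=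
  ∑ y, parabChar e x y * (starRingEnd ℂ) (parabChar e x' y)

omit [DecidableEq F] in
lemma parabKernel_eq_sum (e : AddChar F ℂ) (x x' : (ι → F) × F) :
    parabKernel e x x' =
      ∑ y : ι → F, e ((x'.2 - x.2) * (y ⬝ᵥ y) + y ⬝ᵥ (x'.1 - x.1)) := by
  refine sum_congr rfl fun y _ => ?_
  rw [parabChar, parabChar, ← AddChar.map_neg_eq_conj, ← AddChar.map_add_eq_mul, dotProduct_sub,
    dotProduct_comm y x'.1, dotProduct_comm y x.1]
  congr 1
  ring

lemma parabKernel_of_eq {e : AddChar F ℂ} (he : e ≠ 1) {x x' : (ι → F) × F} (h : x'.2 = x.2) :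
    parabKernel e x x' = if x = x' then (Fintype.card F : ℂ) ^ Fintype.card ι else 0 := by
  rw [parabKernel_eq_sum, h, sub_self]
  simp_rw [zero_mul, zero_add]
  rw [sum_addChar_dotProduct he]
  congr 1
  rw [sub_eq_zero, Prod.ext_iff, h]
  simp [eq_comm]

omit [DecidableEq F] in
lemma parabKernel_of_ne (hF : ringChar F ≠ 2) (e : AddChar F ℂ) {x x' : (ι → F) × F}
    (h : x'.2 ≠ x.2) :
    parabKernel e x x' = e (-(4 * (x'.2 - x.2))⁻¹ * ((x'.1 - x.1) ⬝ᵥ (x'.1 - x.1))) *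
      quadGauss e (x'.2 - x.2) ^ Fintype.card ι := by
  rw [parabKernel_eq_sum, sum_addChar_completeSquare hF e (sub_ne_zero.mpr h)]

omit [DecidableEq F] in
lemma norm_quadGauss (hF : ringChar F ≠ 2) {e : AddChar F ℂ} (he : e ≠ 1) {u : F} (hu : u ≠ 0) :
    ‖quadGauss e u‖ = √(Fintype.card F) := by
  rw [← norm_quadGauss_sq hF he hu, Real.sqrt_sq (norm_nonneg _)]

lemma norm_parabKernel_le (hF : ringChar F ≠ 2) {e : AddChar F ℂ} (he : e ≠ 1)
    (x x' : (ι → F) × F) :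
    ‖parabKernel e x x'‖ ≤ (if x = x' then (Fintype.card F : ℝ) ^ Fintype.card ι else 0) +
      √(Fintype.card F) ^ Fintype.card ι := by
  by_cases h : x'.2 = x.2
  · rw [parabKernel_of_eq he h]
    split_ifs
    · rw [norm_pow, Complex.norm_natCast]
      exact le_add_of_nonneg_right (by positivity)
    · rw [norm_zero]
      positivity
  · rw [parabKernel_of_ne hF e h, norm_mul, AddChar.norm_apply, one_mul, norm_pow,
      norm_quadGauss hF he (sub_ne_zero.mpr h)]
    exact le_add_of_nonneg_left (by split_ifs <;> positivity)

/-- Bound for large supports. -/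
lemma sum_norm_sq_parab_le_of_large {e : AddChar F ℂ} (he : e ≠ 1) (G : Finset ((ι → F) × F))
    (g : (ι → F) × F → ℂ) (hg : ∀ x, ‖g x‖ ≤ 1) :
    ∑ y, ‖∑ x ∈ G, g x * parabChar e x y‖ ^ 2 ≤
      (Fintype.card F : ℝ) ^ (Fintype.card ι + 1) * #G := by
  let φ : (ι → F) × F → (ι → F) × F → ℂ := fun x w => e (-(x.1 ⬝ᵥ w.1 + x.2 * w.2))
  have hφ (x x' : (ι → F) × F) : ∑ w, φ x w * (starRingEnd ℂ) (φ x' w) =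
      if x = x' then (((Fintype.card F : ℝ) ^ (Fintype.card ι + 1) : ℝ) : ℂ) else 0 := by
    have := sum_addChar_prod he (x'.1 - x.1) (x'.2 - x.2)
    simp only [sub_eq_zero, eq_comm (a := x'.1), eq_comm (a := x'.2), ← Prod.ext_iff] at this
    push_cast
    rw [← this]
    refine sum_congr rfl fun w _ => ?_
    simp only [φ]
    rw [← AddChar.map_neg_eq_conj, ← AddChar.map_add_eq_mul, dotProduct_sub,
      dotProduct_comm w.1 x'.1, dotProduct_comm w.1 x.1]
    congr 1
    ring
  calc ∑ y, ‖∑ x ∈ G, g x * parabChar e x y‖ ^ 2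
      = ∑ w ∈ univ.image (fun y : ι → F => (y, y ⬝ᵥ y)), ‖∑ x ∈ G, g x * φ x w‖ ^ 2 := by
        rw [sum_image]
        · rfl
        · intro y _ y' _ h
          exact congrArg Prod.fst h
    _ ≤ ∑ w, ‖∑ x ∈ G, g x * φ x w‖ ^ 2 :=
        sum_le_univ_sum_of_nonneg fun _ => by positivity
    _ = (Fintype.card F : ℝ) ^ (Fintype.card ι + 1) * ∑ x ∈ G, ‖g x‖ ^ 2 :=
        sum_norm_sq_of_orthogonal G g φ _ hφ
    _ ≤ (Fintype.card F : ℝ) ^ (Fintype.card ι + 1) * ∑ x ∈ G, 1 := by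
        gcongr with x
        exact pow_le_one₀ (norm_nonneg _) (hg x)
    _ = _ := by simp

/-- Bound for small supports. -/
lemma sum_norm_sq_parab_le_of_small (hF : ringChar F ≠ 2) {e : AddChar F ℂ} (he : e ≠ 1)
    (G : Finset ((ι → F) × F)) (g : (ι → F) × F → ℂ) (hg : ∀ x, ‖g x‖ ≤ 1) :
    ∑ y, ‖∑ x ∈ G, g x * parabChar e x y‖ ^ 2 ≤
      (Fintype.card F : ℝ) ^ Fintype.card ι * #G +
        √(Fintype.card F) ^ Fintype.card ι * (#G : ℝ) ^ 2 := by
  rw [← Complex.norm_of_nonneg (r := ∑ y, ‖∑ x ∈ G, g x * parabChar e x y‖ ^ 2) (by positivity),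
    sum_norm_sq_expand]
  calc _ ≤ ∑ x ∈ G, ∑ x' ∈ G, ‖parabKernel e x x'‖ := by
        refine (norm_sum_le _ _).trans (sum_le_sum fun x _ => (norm_sum_le _ _).trans
          (sum_le_sum fun x' _ => ?_))
        rw [norm_mul, norm_mul, RCLike.norm_conj]
        exact mul_le_of_le_one_left (norm_nonneg _) (mul_le_one₀ (hg x) (norm_nonneg _) (hg x'))
    _ ≤ ∑ x ∈ G, ∑ x' ∈ G,
          ((if x = x' then (Fintype.card F : ℝ) ^ Fintype.card ι else 0) +
            √(Fintype.card F) ^ Fintype.card ι) :=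
        sum_le_sum fun x _ => sum_le_sum fun x' _ => norm_parabKernel_le hF he x x'
    _ = _ := by
        simp_rw [sum_add_distrib, sum_ite_eq, sum_const]
        rw [← sum_filter, filter_mem_eq_inter, inter_self, sum_const]
        simp only [nsmul_eq_mul]
        ring

/-- The horizontal slice of `G` at height `a`. -/
def horizontalSlice (G : Finset ((ι → F) × F)) (a : F) : Finset (ι → F) :=
  {y | (y, a) ∈ G}

omit [Field F] in
lemma sum_horizontalSlice {M : Type} [AddCommMonoid M] (G : Finset ((ι → F) × F))
    (f : (ι → F) × F → M) :
    ∑ x ∈ G, f x = ∑ a, ∑ y ∈ horizontalSlice G a, f (y, a) :=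
  sum_finset_product_right G univ (horizontalSlice G) (by simp [horizontalSlice])

omit [Field F] in
lemma sum_card_horizontalSlice (G : Finset ((ι → F) × F)) :
    ∑ a, (#(horizontalSlice G a) : ℝ) = #G := by
  have := sum_horizontalSlice G (fun _ => (1 : ℝ))
  simpa using this.symm

/-- The contribution of the slice at height `a` to the off-diagonal part of the `L²` norm. -/
noncomputable def sliceContribution (e : AddChar F ℂ) (G : Finset ((ι → F) × F))
    (g : (ι → F) × F → ℂ) (a : F) : ℝ :=
  ∑ x ∈ G with x.2 ≠ a,
    ‖∑ y ∈ horizontalSlice G a, (starRingEnd ℂ) (g (y, a)) * parabKernel e x (y, a)‖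

lemma sum_norm_sq_parab_le_sum_sliceContribution {e : AddChar F ℂ} (he : e ≠ 1)
    (G : Finset ((ι → F) × F)) (g : (ι → F) × F → ℂ) (hg : ∀ x, ‖g x‖ ≤ 1) :
    ∑ y, ‖∑ x ∈ G, g x * parabChar e x y‖ ^ 2 ≤
      (Fintype.card F : ℝ) ^ Fintype.card ι * #G + ∑ a, sliceContribution e G g a := by
  rw [← Complex.norm_of_nonneg (r := ∑ y, ‖∑ x ∈ G, g x * parabChar e x y‖ ^ 2) (by positivity),
    sum_norm_sq_expand]
  have hrow (x : (ι → F) × F) (hx : x ∈ G) :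
      ‖∑ x' ∈ G, g x * (starRingEnd ℂ) (g x') * parabKernel e x x'‖ ≤
        (Fintype.card F : ℝ) ^ Fintype.card ι +
          ∑ a, if x.2 ≠ a then ‖∑ y ∈ horizontalSlice G a,
            (starRingEnd ℂ) (g (y, a)) * parabKernel e x (y, a)‖ else 0 := by
    have hK (x' : (ι → F) × F) : g x * (starRingEnd ℂ) (g x') * parabKernel e x x' =
        g x * (if x = x' then
          (starRingEnd ℂ) (g x') * (Fintype.card F : ℂ) ^ Fintype.card ι else 0) +
        g x * (if x.2 ≠ x'.2 then (starRingEnd ℂ) (g x') * parabKernel e x x' else 0) := by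
      by_cases h : x'.2 = x.2
      · rw [parabKernel_of_eq he h]
        simp [h]
        ring_nf
      · have h1 : x ≠ x' := fun h1 => h (h1 ▸ rfl)
        have h2 : x.2 ≠ x'.2 := fun h2 => h h2.symm
        rw [if_neg h1, if_pos h2]
        ring
    simp_rw [hK, sum_add_distrib, ← mul_sum]
    rw [sum_ite_eq, if_pos hx, sum_horizontalSlice]
    refine (norm_add_le _ _).trans (add_le_add ?_ ?_)
    · rw [norm_mul, norm_mul, norm_pow, Complex.norm_natCast, RCLike.norm_conj, ← mul_assoc]
      exact mul_le_of_le_one_left (by positivity) (mul_le_one₀ (hg x) (norm_nonneg _) (hg x))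
    · rw [norm_mul]
      refine (mul_le_of_le_one_left (norm_nonneg _) (hg x)).trans ((norm_sum_le _ _).trans
        (sum_le_sum fun a _ => ?_))
      split_ifs <;> simp
  refine (norm_sum_le _ _).trans ((sum_le_sum hrow).trans_eq ?_)
  rw [sum_add_distrib, sum_const, nsmul_eq_mul, mul_comm, sum_comm]
  simp_rw [sliceContribution, sum_filter]

lemma sliceContribution_pow_four_le (hF : ringChar F ≠ 2) {e : AddChar F ℂ} (he : e ≠ 1)
    (G : Finset ((ι → F) × F)) (g : (ι → F) × F → ℂ) (hg : ∀ x, ‖g x‖ ≤ 1) (a : F) :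
    sliceContribution e G g a ^ 4 ≤ (#G : ℝ) ^ 3 *
      (Fintype.card F : ℝ) ^ (3 * Fintype.card ι + 1) *
        parabEnergy (horizontalSlice G a) := by
  have h2 : (2 : F) ≠ 0 := Ring.two_ne_zero hF
  have h4 : (4 : F) ≠ 0 := by
    have : (4 : F) = 2 * 2 := by norm_num
    rw [this]
    exact mul_ne_zero h2 h2
  set q : ℝ := (Fintype.card F : ℝ) with hq
  have hq0 : 0 < q := Nat.cast_pos.mpr Fintype.card_pos
  let A : (ι → F) × F → ℂ := fun x =>
    ∑ y ∈ horizontalSlice G a, (starRingEnd ℂ) (g (y, a)) * parabKernel e x (y, a)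
  let B : (ι → F) × F → ℂ := fun w =>
    ∑ y ∈ horizontalSlice G a, (starRingEnd ℂ) (g (y, a)) * e (w.2 * (y ⬝ᵥ y) + w.1 ⬝ᵥ y)
  let m : (ι → F) × F → (ι → F) × F := fun x =>
    ((2 * (a - x.2))⁻¹ • x.1, -(4 * (a - x.2))⁻¹)
  have hAB (x : (ι → F) × F) (hx : x.2 ≠ a) : ‖A x‖ = √q ^ Fintype.card ι * ‖B (m x)‖ := by
    have ht : a - x.2 ≠ 0 := sub_ne_zero.mpr hx.symm
    have : A x = e (-(4 * (a - x.2))⁻¹ * (x.1 ⬝ᵥ x.1)) * quadGauss e (a - x.2) ^ Fintype.card ι *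
        B (m x) := by
      simp only [A, B, m]
      rw [mul_sum]
      refine sum_congr rfl fun y _ => ?_
      rw [parabKernel_of_ne hF e (x' := (y, a)) hx.symm]
      have hexp : -(4 * (a - x.2))⁻¹ * ((y - x.1) ⬝ᵥ (y - x.1)) =
          -(4 * (a - x.2))⁻¹ * (x.1 ⬝ᵥ x.1) +
            (-(4 * (a - x.2))⁻¹ * (y ⬝ᵥ y) + ((2 * (a - x.2))⁻¹ • x.1) ⬝ᵥ y) := by
        simp only [sub_dotProduct, dotProduct_sub, smul_dotProduct, smul_eq_mul,
          dotProduct_comm y x.1]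
        field_simp
        ring
      rw [hexp, AddChar.map_add_eq_mul]
      ring
    rw [this, norm_mul, norm_mul, AddChar.norm_apply, one_mul, norm_pow,
      norm_quadGauss hF he ht]
  have hinj : Set.InjOn m ({x | x.2 ≠ a} : Finset ((ι → F) × F)) := by
    intro x hx x' hx' h
    have hx1 : a - x.2 ≠ 0 := sub_ne_zero.mpr (Ne.symm (by simpa using hx))
    have hx1' : a - x'.2 ≠ 0 := sub_ne_zero.mpr (Ne.symm (by simpa using hx'))
    simp only [m, Prod.mk.injEq, neg_inj, inv_inj] at h
    have h5 := mul_left_cancel₀ h4 h.2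
    rw [h5] at h
    refine Prod.ext ?_ (sub_right_injective h5)
    exact smul_right_injective _ (inv_ne_zero (mul_ne_zero h2 hx1')) h.1
  have hfour : (√q ^ Fintype.card ι) ^ 4 = q ^ (2 * Fintype.card ι) := by
    rw [← pow_mul, show Fintype.card ι * 4 = 2 * (2 * Fintype.card ι) by ring,
      pow_mul, Real.sq_sqrt hq0.le]
  calc sliceContribution e G g a ^ 4
      ≤ (#{x ∈ G | x.2 ≠ a} : ℝ) ^ 3 * ∑ x ∈ G with x.2 ≠ a, ‖A x‖ ^ 4 :=
        pow_sum_le_card_mul_sum_pow (fun _ _ => norm_nonneg _) 3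
    _ ≤ (#G : ℝ) ^ 3 * ∑ x with x.2 ≠ a, ‖A x‖ ^ 4 := by
        gcongr
        · exact filter_subset _ _
        · exact subset_univ G
    _ = (#G : ℝ) ^ 3 * (q ^ (2 * Fintype.card ι) * ∑ x with x.2 ≠ a, ‖B (m x)‖ ^ 4) := by
        congr 1
        rw [mul_sum]
        refine sum_congr rfl fun x hx => ?_
        rw [hAB x (mem_filter.mp hx).2, mul_pow, hfour]
    _ ≤ (#G : ℝ) ^ 3 * (q ^ (2 * Fintype.card ι) * ∑ w, ‖B w‖ ^ 4) := by
        rw [← sum_image (f := fun w => ‖B w‖ ^ 4) hinj]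
        gcongr
        exact subset_univ _
    _ ≤ (#G : ℝ) ^ 3 * (q ^ (2 * Fintype.card ι) * (q ^ (Fintype.card ι + 1) *
          parabEnergy (horizontalSlice G a))) := by
        gcongr
        exact sum_norm_extension_pow_four_le he _ _ fun y => by
          rw [RCLike.norm_conj]; exact hg _
    _ = _ := by ring

lemma le_mul_of_pow_four_le {q M m D c : ℝ} {k : ℕ} (hq : 0 < q) (hM : 0 < M) (hm : 0 ≤ m)
    (hMq : M ≤ q ^ (k + 2)) (hc : 0 ≤ c) (hc4 : c ^ 4 = 4 * M ^ 5 * q ^ (7 * k + 2))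
    (hD : D ^ 4 ≤ M ^ 3 * q ^ (3 * (2 * k + 1) + 1) * (2 * (m ^ 3 / q + q ^ k * m ^ 2))) :
    D ≤ c * (1 + m * (q / M)) := by
  obtain ⟨r, hr⟩ : ∃ r, r = m * (q / M) := ⟨_, rfl⟩
  have hr0 : 0 ≤ r := by rw [hr]; positivity
  have hmr : m = r * M / q := by rw [hr]; field_simp
  rw [← hr]
  refine le_of_pow_le_pow_left₀ (n := 4) (by norm_num) (by positivity) (hD.trans ?_)
  have h1 : m ^ 3 / q ≤ r ^ 3 * (q ^ k * M ^ 2 / q ^ 2) := by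
    rw [hmr]
    calc (r * M / q) ^ 3 / q = r ^ 3 * (M * M ^ 2 / q ^ 4) := by field_simp
      _ ≤ r ^ 3 * (q ^ (k + 2) * M ^ 2 / q ^ 4) := by gcongr
      _ = _ := by rw [pow_add]; field_simp
  have h2 : q ^ k * m ^ 2 = r ^ 2 * (q ^ k * M ^ 2 / q ^ 2) := by
    rw [hmr]; field_simp
  have h3 : r ^ 3 + r ^ 2 ≤ 2 * (1 + r) ^ 4 := by
    nlinarith [pow_nonneg hr0 2, pow_nonneg hr0 3, pow_nonneg hr0 4]
  calc M ^ 3 * q ^ (3 * (2 * k + 1) + 1) * (2 * (m ^ 3 / q + q ^ k * m ^ 2))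
      ≤ M ^ 3 * q ^ (3 * (2 * k + 1) + 1) * (2 * (r ^ 3 * (q ^ k * M ^ 2 / q ^ 2) +
          r ^ 2 * (q ^ k * M ^ 2 / q ^ 2))) := by
        rw [h2]; gcongr
    _ = M ^ 3 * q ^ (3 * (2 * k + 1) + 1) * (2 * ((q ^ k * M ^ 2 / q ^ 2) * (r ^ 3 + r ^ 2))) := by
        ring
    _ ≤ M ^ 3 * q ^ (3 * (2 * k + 1) + 1) *
          (2 * ((q ^ k * M ^ 2 / q ^ 2) * (2 * (1 + r) ^ 4))) := by
        gcongr
    _ = (c * (1 + r)) ^ 4 := by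
        rw [mul_pow, hc4]
        field_simp
        ring

/-- Bound for supports of intermediate size. -/
lemma sum_norm_sq_parab_le_of_medium (hF : ringChar F ≠ 2) {e : AddChar F ℂ} (he : e ≠ 1) {k : ℕ}
    (hk : Fintype.card ι = 2 * k + 1) {G : Finset ((ι → F) × F)} (hG : 0 < (#G : ℝ))
    (hGq : (#G : ℝ) ≤ (Fintype.card F : ℝ) ^ (k + 2)) (g : (ι → F) × F → ℂ)
    (hg : ∀ x, ‖g x‖ ≤ 1) {c : ℝ} (hc : 0 ≤ c)
    (hc4 : c ^ 4 = 4 * (#G : ℝ) ^ 5 * (Fintype.card F : ℝ) ^ (7 * k + 2)) :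
    ∑ y, ‖∑ x ∈ G, g x * parabChar e x y‖ ^ 2 ≤
      (Fintype.card F : ℝ) ^ Fintype.card ι * #G + 2 * Fintype.card F * c := by
  have hq0 : (0 : ℝ) < Fintype.card F := Nat.cast_pos.mpr Fintype.card_pos
  refine (sum_norm_sq_parab_le_sum_sliceContribution he G g hg).trans ?_
  gcongr
  calc ∑ a, sliceContribution e G g a
      ≤ ∑ a, c * (1 + #(horizontalSlice G a) * ((Fintype.card F : ℝ) / #G)) := by
        refine sum_le_sum fun a _ => le_mul_of_pow_four_le hq0 hG (by positivity) hGq hc hc4 ?_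
        rw [← hk]
        refine (sliceContribution_pow_four_le hF he G g hg a).trans ?_
        gcongr
        exact parabEnergy_le hF he hk _
    _ = 2 * Fintype.card F * c := by
        rw [← mul_sum, sum_add_distrib, ← sum_mul, sum_card_horizontalSlice]
        simp only [sum_const, card_univ, nsmul_eq_mul, mul_one]
        field_simp
        ring

end Restriction
lemma rpow_half_le {a b : ℝ} (hb : 0 ≤ b) (h : a ≤ b ^ 2) : a ^ ((1 : ℝ) / 2) ≤ b := by
  rw [← Real.sqrt_eq_rpow]
  exact Real.sqrt_le_iff.mpr ⟨hb, h⟩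

lemma fourierP_eq_sum {F : Type} [Field F] [Fintype F] {d : ℕ} (e : AddChar F ℂ)
    {g : (Fin (d - 1) → F) × F → ℂ} {G : Finset ((Fin (d - 1) → F) × F)}
    (hG : ∀ x, x ∈ G ↔ g x ≠ 0) (y : Fin (d - 1) → F) :
    fourierP e g y = ∑ x ∈ G, g x * parabChar e x y := by
  refine (sum_subset (subset_univ G) fun x _ hx => ?_).symm
  rw [not_not.mp (mt (hG x).mpr hx), zero_mul]

lemma rpow_pow_four_mul_pow {q M D k : ℝ} (hq : 0 < q) (hM : 0 ≤ M) (hD : D = 2 * k + 2) :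
    (q ^ ((6 - D) / 8) * M ^ ((5 : ℝ) / 4)) ^ 4 * q ^ k = q ^ 2 * M ^ 5 := by
  rw [mul_pow, ← Real.rpow_mul_natCast hq.le, ← Real.rpow_mul_natCast hM, mul_right_comm,
    ← Real.rpow_add hq, ← Real.rpow_natCast q 2, ← Real.rpow_natCast M 5, hD]
  congr 2
  · push_cast; ring
  · norm_num

lemma le_rpow_mul_rpow {q M D k : ℝ} (hq : 1 ≤ q) (hM : 0 < M) (hD : D = 2 * k + 2)
    (h : q ^ ((3 * D + 2) / 6) ≤ M) : M ≤ q ^ ((6 - D) / 8) * M ^ ((5 : ℝ) / 4) := by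
  have hq0 : 0 < q := by linarith
  refine le_of_pow_le_pow_left₀ (n := 4) (by norm_num) (by positivity) ?_
  refine le_of_mul_le_mul_right ?_ (Real.rpow_pos_of_pos hq0 k)
  have hkM : q ^ k ≤ M := (Real.rpow_le_rpow_of_exponent_le hq (by rw [hD]; linarith)).trans h
  rw [rpow_pow_four_mul_pow hq0 hM.le hD]
  calc M ^ 4 * q ^ k ≤ M ^ 4 * M := by gcongr
    _ = 1 * M ^ 5 := by ring
    _ ≤ q ^ 2 * M ^ 5 := by gcongr; exact one_le_pow₀ hq

/-- Let `d ≥ 4` be even. There is `C = C(d) > 0` such that for every finite field `F` of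
odd characteristic, every nontrivial additive character `e`, and every `g : F^d → ℂ` with
`|g| ≤ 1` and support `G`:
(i) if `|F|^{(d+2)/2} ≤ |G| ≤ |F|^d` then `‖ĝ‖_{L²(P,dσ)} ≤ C |F|^{1/2} |G|^{1/2}`;
(ii) if `|F|^{(3d+2)/6} ≤ |G| ≤ |F|^{(d+2)/2}` then `‖ĝ‖ ≤ C |F|^{(6-d)/16} |G|^{5/8}`;
(iii) if `1 ≤ |G| ≤ |F|^{(3d+2)/6}` then `‖ĝ‖ ≤ C (|G|^{1/2} + |F|^{(1-d)/4} |G|)`. -/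
theorem stmt6 (d : ℕ) (hd : 4 ≤ d) (hdeven : Even d) :
    ∃ C : ℝ, 0 < C ∧
      ∀ (F : Type) [Field F] [Fintype F], ringChar F ≠ 2 →
      ∀ (e : AddChar F ℂ), e ≠ 1 →
      ∀ g : (Fin (d - 1) → F) × F → ℂ, (∀ x, ‖g x‖ ≤ 1) →
      ∀ G : Finset ((Fin (d - 1) → F) × F), (∀ x, x ∈ G ↔ g x ≠ 0) →
        (((Fintype.card F : ℝ) ^ (((d : ℝ) + 2) / 2) ≤ (G.card : ℝ) ∧
            (G.card : ℝ) ≤ (Fintype.card F : ℝ) ^ (d : ℝ) →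
          l2P e g ≤ C * (Fintype.card F : ℝ) ^ ((1 : ℝ) / 2) *
            (G.card : ℝ) ^ ((1 : ℝ) / 2)) ∧
        ((Fintype.card F : ℝ) ^ ((3 * (d : ℝ) + 2) / 6) ≤ (G.card : ℝ) ∧
            (G.card : ℝ) ≤ (Fintype.card F : ℝ) ^ (((d : ℝ) + 2) / 2) →
          l2P e g ≤ C * (Fintype.card F : ℝ) ^ ((6 - (d : ℝ)) / 16) *
            (G.card : ℝ) ^ ((5 : ℝ) / 8)) ∧
        (1 ≤ (G.card : ℝ) ∧ (G.card : ℝ) ≤ (Fintype.card F : ℝ) ^ ((3 * (d : ℝ) + 2) / 6) →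
          l2P e g ≤ C * ((G.card : ℝ) ^ ((1 : ℝ) / 2) +
            (Fintype.card F : ℝ) ^ ((1 - (d : ℝ)) / 4) * (G.card : ℝ)))) := by
  obtain ⟨k, hk⟩ : ∃ k, d = 2 * k + 2 := by
    obtain ⟨m, hm⟩ := hdeven
    exact ⟨m - 1, by omega⟩
  have hn : d - 1 = 2 * k + 1 := by omega
  have hdk : (d : ℝ) = 2 * (k : ℝ) + 2 := by exact_mod_cast hk
  refine ⟨2, by norm_num, fun F _ _ hF e he g hg G hG => ?_⟩
  classical
  have hcard : Fintype.card (Fin (d - 1)) = 2 * k + 1 := by rw [Fintype.card_fin, hn]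
  have hlarge := sum_norm_sq_parab_le_of_large he G g hg
  have hsmall := sum_norm_sq_parab_le_of_small hF he G g hg
  have hmedium := fun hG0 hGq (c : ℝ) =>
    sum_norm_sq_parab_le_of_medium hF he hcard (G := G) hG0 hGq g hg (c := c)
  simp_rw [hcard, ← fourierP_eq_sum e hG] at hlarge hsmall hmedium
  have hq1 : (1 : ℝ) ≤ Fintype.card F := Nat.one_le_cast.mpr Fintype.card_pos
  simp_rw [l2P, hn]
  generalize (Fintype.card F : ℝ) = q at *
  generalize hM : (#G : ℝ) = M at *
  have hM0 : 0 ≤ M := hM ▸ Nat.cast_nonneg _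
  generalize ∑ y, ‖fourierP e g y‖ ^ 2 = T at *
  have hq0 : 0 < q := by linarith
  refine ⟨fun _ => ?_, fun ⟨hlow, hup⟩ => ?_, fun _ => ?_⟩
  · refine rpow_half_le (by positivity) ?_
    rw [inv_mul_le_iff₀ (by positivity), mul_pow, mul_pow, ← Real.sqrt_eq_rpow, ← Real.sqrt_eq_rpow,
      Real.sq_sqrt hq0.le, Real.sq_sqrt hM0]
    have : 0 ≤ q ^ (2 * k + 1 + 1) * M := by positivity
    calc T ≤ q ^ (2 * k + 1 + 1) * M := hlarge
      _ ≤ 4 * (q ^ (2 * k + 1 + 1) * M) := by linarith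
      _ = _ := by ring
  · have hMpos : 0 < M := (Real.rpow_pos_of_pos hq0 _).trans_le hlow
    obtain ⟨x, hx⟩ : ∃ x, x = q ^ ((6 - (d : ℝ)) / 8) * M ^ ((5 : ℝ) / 4) := ⟨_, rfl⟩
    have hx0 : 0 ≤ x := by rw [hx]; positivity
    have hMx : M ≤ x := hx ▸ le_rpow_mul_rpow hq1 hMpos hdk hlow
    have hx4 : x ^ 4 * q ^ k = q ^ 2 * M ^ 5 := by
      rw [hx, ← Real.rpow_natCast q k]
      exact rpow_pow_four_mul_pow hq0 hM0 hdk
    have hMq : M ≤ q ^ (k + 2) := by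
      refine hup.trans_eq ?_
      rw [hdk, ← Real.rpow_natCast]
      congr 1
      push_cast
      ring
    have hsqrt : √2 ^ 4 = (4 : ℝ) := by
      rw [show 4 = 2 * 2 from rfl, pow_mul, Real.sq_sqrt (by norm_num)]
      norm_num
    have hsqrt' : √2 ≤ (3 : ℝ) / 2 := Real.sqrt_le_iff.mpr (by norm_num)
    have hT := hmedium hMpos hMq (√2 * x * q ^ (2 * k)) (by positivity) (by
      rw [mul_pow, mul_pow, hsqrt]
      linear_combination 4 * q ^ (7 * k) * hx4)
    refine rpow_half_le (by positivity) ?_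
    have hsq : (2 * q ^ ((6 - (d : ℝ)) / 16) * M ^ ((5 : ℝ) / 8)) ^ 2 = 4 * x := by
      rw [hx, mul_pow, mul_pow, ← Real.rpow_mul_natCast hq0.le, ← Real.rpow_mul_natCast hM0,
        mul_assoc]
      congr 2
      · norm_num
      · congr 1
        push_cast
        ring
      · norm_num
    rw [inv_mul_le_iff₀ (by positivity), hsq]
    calc T ≤ q ^ (2 * k + 1) * M + 2 * q * (√2 * x * q ^ (2 * k)) := hT
      _ ≤ q ^ (2 * k + 1) * x + 2 * q * (3 / 2 * x * q ^ (2 * k)) := by gcongr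
      _ = _ := by ring
  · refine rpow_half_le (by positivity) ?_
    have hsq : (q ^ ((1 - (d : ℝ)) / 4)) ^ 2 * √q ^ (2 * k + 1) = 1 := by
      rw [Real.sqrt_eq_rpow, ← Real.rpow_mul_natCast hq0.le, ← Real.rpow_mul_natCast hq0.le,
        ← Real.rpow_add hq0, hdk]
      convert Real.rpow_zero q using 2
      push_cast
      ring
    have hroot : q ^ (2 * k + 1) = (√q ^ (2 * k + 1)) ^ 2 := by
      rw [pow_right_comm, Real.sq_sqrt hq0.le]
    have hMroot : (M ^ ((1 : ℝ) / 2)) ^ 2 = M := by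
      rw [← Real.sqrt_eq_rpow, Real.sq_sqrt hM0]
    have hy0 : 0 ≤ q ^ ((1 - (d : ℝ)) / 4) := by positivity
    have hz0 : 0 ≤ M ^ ((1 : ℝ) / 2) := by positivity
    generalize q ^ ((1 - (d : ℝ)) / 4) = y at *
    generalize M ^ ((1 : ℝ) / 2) = z at *
    rw [inv_mul_le_iff₀ (by positivity)]
    refine hsmall.trans ?_
    have hprod : √q ^ (2 * k + 1) * M ^ 2 = q ^ (2 * k + 1) * (y * M) ^ 2 := by
      rw [hroot]
      linear_combination (-(√q ^ (2 * k + 1)) * M ^ 2) * hsq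
    rw [hprod, ← mul_add]
    gcongr
    rw [← hMroot]
    nlinarith [mul_nonneg hz0 (mul_nonneg hy0 (sq_nonneg z)), sq_nonneg z,
      sq_nonneg (y * z ^ 2)]
end

section
/- Let n ≥ 3 be an odd integer. There exists a constant C = C(n) > 0 such that for every finite field F of odd characteristic and every subset A ⊆ F^n, the number of pairs (y,z) ∈ A × A with (z − y)·(z − y) = 0 is at most C ( |F|^{-1} |A|² + |F|^{(n-1)/2} |A| ). -/
open Finset

namespace FiniteFieldSphere

variable {F : Type*} [Field F] [Fintype F] [DecidableEq F]

/-- The quadratic character of a finite field with complex values. -/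
noncomputable def quadCharC (F : Type*) [Field F] [Fintype F] [DecidableEq F] : MulChar F ℂ :=
  (quadraticChar F).ringHomComp (Int.castRingHom ℂ)

lemma quadCharC_apply (a : F) : quadCharC F a = ((quadraticChar F a : ℤ) : ℂ) := rfl

lemma quadCharC_ne_one (hF : ringChar F ≠ 2) : quadCharC F ≠ 1 :=
  (MulChar.ringHomComp_ne_one_iff Int.cast_injective).mpr (quadraticChar_ne_one hF)

lemma quadCharC_isQuadratic : (quadCharC F).IsQuadratic :=
  (quadraticChar_isQuadratic F).comp _

lemma quadCharC_mul_self {a : F} (ha : a ≠ 0) : quadCharC F a * quadCharC F a = 1 := by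
  rw [quadCharC_apply, ← Int.cast_mul, ← pow_two, quadraticChar_sq_one ha, Int.cast_one]

lemma quadCharC_zero : quadCharC F 0 = 0 :=
  MulChar.map_zero _

lemma norm_quadCharC_le (a : F) : ‖quadCharC F a‖ ≤ 1 := by
  rcases quadCharC_isQuadratic a with h | h | h <;> simp [h]

lemma sum_quadCharC_mul (hF : ringChar F ≠ 2) (ψ : AddChar F ℂ) (b : F) :
    ∑ s, quadCharC F s * ψ (s * b) = quadCharC F b * gaussSum (quadCharC F) ψ := by
  rcases eq_or_ne b 0 with rfl | hb
  · simp [quadCharC_zero, MulChar.sum_eq_zero_of_ne_one (quadCharC_ne_one hF)]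
  · rw [← gaussSum_mulShift (quadCharC F) ψ (Units.mk0 b hb), ← mul_assoc, Units.val_mk0,
      quadCharC_mul_self hb, one_mul]
    simp [gaussSum, AddChar.mulShift_apply, mul_comm]

lemma sum_addChar_mul_sq (hF : ringChar F ≠ 2) {ψ : AddChar F ℂ} (hψ : ψ.IsPrimitive)
    {s : F} (hs : s ≠ 0) :
    ∑ x, ψ (s * x ^ 2) = quadCharC F s * gaussSum (quadCharC F) ψ := by
  have hfib (y : F) : ∑ x with x ^ 2 = y, ψ (s * x ^ 2) = (quadCharC F y + 1) * ψ (y * s) := by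
    have hcard : ((#{x : F | x ^ 2 = y} : ℕ) : ℤ) = quadraticChar F y + 1 := by
      rw [← quadraticChar_card_sqrts hF y]
      congr 2
      ext; simp
    have hcard' : ((#{x : F | x ^ 2 = y} : ℕ) : ℂ) = quadCharC F y + 1 := by
      rw [quadCharC_apply]; exact_mod_cast hcard
    rw [← hcard', ← nsmul_eq_mul]
    refine Finset.sum_eq_card_nsmul fun x hx => ?_
    rw [(Finset.mem_filter.mp hx).2, mul_comm]
  rw [← Finset.sum_fiberwise univ (fun x : F => x ^ 2)]
  simp_rw [hfib, add_mul, one_mul, Finset.sum_add_distrib]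
  rw [AddChar.sum_mulShift s hψ, if_neg hs, sum_quadCharC_mul hF]
  simp

lemma sum_addChar_quadratic (hF : ringChar F ≠ 2) {ψ : AddChar F ℂ} (hψ : ψ.IsPrimitive)
    {s : F} (hs : s ≠ 0) (u : F) :
    ∑ x, ψ (s * x ^ 2 + x * u) =
      quadCharC F s * gaussSum (quadCharC F) ψ * ψ (s⁻¹ * (-u ^ 2 / 4)) := by
  have h2 : (2 : F) ≠ 0 := Ring.two_ne_zero hF
  rw [← sum_addChar_mul_sq hF hψ hs, Finset.sum_mul,
    ← Equiv.sum_comp (Equiv.addRight (u / (2 * s))) (fun x => ψ (s * x ^ 2) * _)]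
  refine Finset.sum_congr rfl fun x _ => ?_
  rw [← AddChar.map_add_eq_mul, Equiv.coe_addRight]
  congr 1
  rw [show (4 : F) = 2 * 2 by norm_num]
  field_simp
  ring

lemma sum_addChar_inv_mul {ψ : AddChar F ℂ} (hψ : ψ.IsPrimitive) (c : F) :
    ∑ s, (if s = 0 then 0 else ψ (s⁻¹ * c)) =
      (if c = 0 then (Fintype.card F : ℂ) else 0) - 1 := by
  have h : ∑ s, (if s = 0 then 0 else ψ (s⁻¹ * c)) = ∑ s, (if s = 0 then 0 else ψ (s * c)) := by
    rw [← Equiv.sum_comp (Equiv.inv F) (fun s => if s = 0 then 0 else ψ (s * c))]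
    simp
  have h' (s : F) : (if s = 0 then 0 else ψ (s * c)) = ψ (s * c) - if s = 0 then 1 else 0 := by
    split_ifs with hs <;> simp [hs]
  simp_rw [h, h', Finset.sum_sub_distrib, AddChar.sum_mulShift c hψ]
  simp

lemma prod_addChar {G M ι : Type*} [AddCommMonoid G] [CommMonoid M] (ψ : AddChar G M)
    (s : Finset ι) (f : ι → G) :
    ψ (∑ i ∈ s, f i) = ∏ i ∈ s, ψ (f i) := by
  classical
  induction s using Finset.induction_on with
  | empty => simp
  | insert a s ha ih => rw [sum_insert ha, prod_insert ha, AddChar.map_add_eq_mul, ih]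

lemma sum_addChar_pi {G M ι : Type*} [AddCommMonoid G] [Fintype G] [CommSemiring M] [Fintype ι]
    [DecidableEq ι] (ψ : AddChar G M) (f : ι → G → G) :
    ∑ ξ : ι → G, ψ (∑ i, f i (ξ i)) = ∏ i, ∑ x, ψ (f i x) := by
  simp_rw [prod_addChar, Finset.prod_univ_sum, Fintype.piFinset_univ]

lemma gaussSum_pow_mul_indicator (hF : ringChar F ≠ 2) {ψ : AddChar F ℂ} (hψ : ψ.IsPrimitive)
    (m : ℕ) (u : Fin (2 * m + 1) → F) :
    gaussSum (quadCharC F) ψ ^ (2 * m) *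
        ((if ∑ i, u i * u i = 0 then (Fintype.card F : ℂ) else 0) - 1) =
      ∑ ξ : Fin (2 * m + 1) → F, quadCharC F (∑ i, ξ i ^ 2) * ψ (∑ i, ξ i * u i) := by
  have h4 : (4 : F) ≠ 0 := by
    rw [show (4 : F) = 2 * 2 by norm_num]
    exact mul_ne_zero (Ring.two_ne_zero hF) (Ring.two_ne_zero hF)
  set g := gaussSum (quadCharC F) ψ with hg
  have hg0 : g ≠ 0 :=
    gaussSum_ne_zero_of_nontrivial (Nat.cast_ne_zero.mpr Fintype.card_ne_zero)
      (quadCharC_ne_one hF) hψ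
  have hc : (∑ i, -u i ^ 2 / 4 = 0) ↔ ∑ i, u i * u i = 0 := by
    rw [← Finset.sum_div, Finset.sum_neg_distrib, div_eq_zero_iff, neg_eq_zero]
    simp [h4, pow_two]
  have key (s : F) : quadCharC F s * ∑ ξ : Fin (2 * m + 1) → F,
      ψ (s * (∑ i, ξ i ^ 2)) * ψ (∑ i, ξ i * u i) =
      g ^ (2 * m + 1) * if s = 0 then 0 else ψ (s⁻¹ * ∑ i, -u i ^ 2 / 4) := by
    rcases eq_or_ne s 0 with rfl | hs
    · simp [quadCharC_zero]
    have h1 : ∑ ξ : Fin (2 * m + 1) → F, ψ (s * (∑ i, ξ i ^ 2)) * ψ (∑ i, ξ i * u i) =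
        ∏ i, (quadCharC F s * g * ψ (s⁻¹ * (-u i ^ 2 / 4))) := by
      simp_rw [hg, ← sum_addChar_quadratic hF hψ hs, ← sum_addChar_pi ψ
        (fun i x => s * x ^ 2 + x * u i), ← AddChar.map_add_eq_mul, Finset.mul_sum,
        Finset.sum_add_distrib]
    have h3 : quadCharC F s * quadCharC F s ^ (2 * m + 1) = 1 := by
      rw [← pow_succ', show 2 * m + 1 + 1 = 2 * (m + 1) by ring, pow_mul, pow_two,
        quadCharC_mul_self hs, one_pow]
    rw [h1, if_neg hs, Finset.mul_sum, prod_addChar, Finset.prod_mul_distrib, Finset.prod_const,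
      Finset.card_univ, Fintype.card_fin, mul_pow, ← mul_assoc, ← mul_assoc, h3, one_mul]
  apply mul_left_cancel₀ hg0
  calc g * (g ^ (2 * m) * ((if ∑ i, u i * u i = 0 then (Fintype.card F : ℂ) else 0) - 1))
      = ∑ s, g ^ (2 * m + 1) * if s = 0 then 0 else ψ (s⁻¹ * ∑ i, -u i ^ 2 / 4) := by
        rw [← Finset.mul_sum, sum_addChar_inv_mul hψ, if_congr hc rfl rfl]
        ring
    _ = ∑ ξ : Fin (2 * m + 1) → F, (∑ s, quadCharC F s * ψ (s * (∑ i, ξ i ^ 2))) *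
          ψ (∑ i, ξ i * u i) := by
        simp_rw [← key, Finset.mul_sum, Finset.sum_mul]
        rw [Finset.sum_comm]
        simp_rw [mul_assoc]
    _ = _ := by
        simp_rw [sum_quadCharC_mul hF, Finset.mul_sum]
        refine Finset.sum_congr rfl fun ξ _ => ?_
        ring

lemma norm_gaussSum_sq (hF : ringChar F ≠ 2) {ψ : AddChar F ℂ} (hψ : ψ.IsPrimitive) :
    ‖gaussSum (quadCharC F) ψ‖ ^ 2 = Fintype.card F := by
  rw [← norm_pow, gaussSum_sq (quadCharC_ne_one hF) quadCharC_isQuadratic hψ, norm_mul]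
  have h : ‖quadCharC F (-1)‖ = 1 := by
    have := congrArg norm (quadCharC_mul_self (neg_ne_zero.mpr (one_ne_zero (α := F))))
    rw [norm_mul, norm_one] at this
    nlinarith [norm_nonneg (quadCharC F (-1))]
  simp [h]

lemma sum_sum_addChar_sub {R ι : Type*} [CommRing R] [Finite R] [Fintype ι] (ψ : AddChar R ℂ)
    (A : Finset (ι → R)) (ξ : ι → R) :
    ∑ y ∈ A, ∑ z ∈ A, ψ (∑ i, ξ i * (z i - y i)) =
      ((‖∑ z ∈ A, ψ (∑ i, ξ i * z i)‖ ^ 2 : ℝ) : ℂ) := by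
  push_cast
  rw [← Complex.mul_conj', map_sum, Finset.sum_mul_sum, Finset.sum_comm]
  refine Finset.sum_congr rfl fun z _ => Finset.sum_congr rfl fun y _ => ?_
  rw [← AddChar.map_neg_eq_conj, ← AddChar.map_add_eq_mul, ← sub_eq_add_neg,
    ← Finset.sum_sub_distrib]
  simp_rw [mul_sub]

section Plancherel

variable {ι : Type*} [Fintype ι] [DecidableEq ι]

lemma sum_addChar_dot {ψ : AddChar F ℂ} (hψ : ψ.IsPrimitive) (w : ι → F) :
    ∑ ξ : ι → F, ψ (∑ i, ξ i * w i) =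
      if w = 0 then (Fintype.card F : ℂ) ^ Fintype.card ι else 0 := by
  rw [sum_addChar_pi ψ (fun i x => x * w i)]
  simp_rw [AddChar.sum_mulShift _ hψ]
  split_ifs with hw
  · simp [hw]
  · obtain ⟨i, hi⟩ := Function.ne_iff.mp hw
    exact Finset.prod_eq_zero (Finset.mem_univ i) (by simpa using hi)

lemma sum_norm_sq_fourier {ψ : AddChar F ℂ} (hψ : ψ.IsPrimitive) (A : Finset (ι → F)) :
    ∑ ξ : ι → F, ‖∑ z ∈ A, ψ (∑ i, ξ i * z i)‖ ^ 2 =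
      (Fintype.card F : ℝ) ^ Fintype.card ι * #A := by
  apply Complex.ofReal_injective
  rw [Complex.ofReal_sum]
  simp_rw [← sum_sum_addChar_sub]
  rw [Finset.sum_comm]
  simp_rw [Finset.sum_comm (s := univ) (t := A)]
  have h (y z : ι → F) : ∑ ξ : ι → F, ψ (∑ i, ξ i * (z i - y i)) =
      if y = z then (Fintype.card F : ℂ) ^ Fintype.card ι else 0 := by
    rw [← if_congr (show z - y = 0 ↔ y = z by rw [sub_eq_zero, eq_comm]) rfl rfl]
    exact sum_addChar_dot hψ (z - y)
  simp_rw [h, Finset.sum_ite_eq]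
  rw [Finset.sum_ite_of_true (fun _ h => h)]
  simp [mul_comm]

end Plancherel

lemma card_isotropic_pairs_le (hF : ringChar F ≠ 2) (m : ℕ)
    (A : Finset (Fin (2 * m + 1) → F)) :
    (#{p ∈ A ×ˢ A | ∑ i, (p.2 i - p.1 i) * (p.2 i - p.1 i) = 0} : ℝ) ≤
      (Fintype.card F : ℝ)⁻¹ * (#A : ℝ) ^ 2 + (Fintype.card F : ℝ) ^ m * #A := by
  set N := #{p ∈ A ×ˢ A | ∑ i, (p.2 i - p.1 i) * (p.2 i - p.1 i) = 0} with hN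
  obtain ⟨ψ, hψ⟩ : ∃ ψ : AddChar F ℂ, ψ.IsPrimitive :=
    ⟨_, AddChar.FiniteField.primitiveChar_to_Complex_isPrimitive F⟩
  set q : ℝ := (Fintype.card F : ℝ) with hq
  have hq0 : 0 < q := Nat.cast_pos.mpr Fintype.card_pos
  set g := gaussSum (quadCharC F) ψ with hg
  have hsum : g ^ (2 * m) * ((Fintype.card F : ℂ) * N - (#A : ℂ) ^ 2) =
      ∑ ξ : Fin (2 * m + 1) → F, quadCharC F (∑ i, ξ i ^ 2) *
        ((‖∑ z ∈ A, ψ (∑ i, ξ i * z i)‖ ^ 2 : ℝ) : ℂ) := by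
    have hcount : (Fintype.card F : ℂ) * N - (#A : ℂ) ^ 2 = ∑ y ∈ A, ∑ z ∈ A,
        ((if ∑ i, (z i - y i) * (z i - y i) = 0 then (Fintype.card F : ℂ) else 0) - 1) := by
      rw [← Finset.sum_product' A A (fun y z => (if ∑ i, (z i - y i) * (z i - y i) = 0
        then (Fintype.card F : ℂ) else 0) - 1), Finset.sum_sub_distrib, ← Finset.sum_filter]
      simp [hN, pow_two, mul_comm]
    rw [hcount]
    simp_rw [← sum_sum_addChar_sub, Finset.mul_sum]
    rw [Finset.sum_comm (s := univ)]
    refine Finset.sum_congr rfl fun y _ => ?_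
    rw [Finset.sum_comm]
    exact Finset.sum_congr rfl fun z _ => gaussSum_pow_mul_indicator hF hψ m (fun i => z i - y i)
  have hnorm : q ^ m * |q * N - (#A : ℝ) ^ 2| ≤ q ^ (2 * m + 1) * #A := by
    calc q ^ m * |q * N - (#A : ℝ) ^ 2|
        = ‖g ^ (2 * m) * ((Fintype.card F : ℂ) * N - (#A : ℂ) ^ 2)‖ := by
          rw [norm_mul, norm_pow, pow_mul, norm_gaussSum_sq hF hψ, ← Real.norm_eq_abs,
            ← Complex.norm_real]
          push_cast [hq]
          rfl
      _ ≤ ∑ ξ : Fin (2 * m + 1) → F, ‖∑ z ∈ A, ψ (∑ i, ξ i * z i)‖ ^ 2 := by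
          rw [hsum]
          refine norm_sum_le_of_le _ fun ξ _ => ?_
          rw [norm_mul, Complex.norm_real, Real.norm_of_nonneg (sq_nonneg _)]
          exact mul_le_of_le_one_left (sq_nonneg _) (norm_quadCharC_le _)
      _ = q ^ (2 * m + 1) * #A := by
          rw [sum_norm_sq_fourier hψ, Fintype.card_fin]
  have hdiff : q * N - (#A : ℝ) ^ 2 ≤ q ^ (m + 1) * #A := by
    refine (le_abs_self _).trans (le_of_mul_le_mul_left (hnorm.trans_eq ?_) (pow_pos hq0 m))
    ring
  refine le_of_mul_le_mul_left ?_ hq0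
  rw [mul_add, mul_inv_cancel_left₀ hq0.ne']
  linarith [show q * (q ^ m * #A) = q ^ (m + 1) * (#A : ℝ) by ring]

end FiniteFieldSphere

/-- Let `n ≥ 3` be odd. There is `C = C(n) > 0` such that for every finite field `F` of
odd characteristic and every `A ⊆ F^n`, the number of pairs `(y,z) ∈ A × A` with
`(z − y)·(z − y) = 0` is at most `C (|F|⁻¹ |A|² + |F|^{(n-1)/2} |A|)`. -/
theorem stmt9 (n : ℕ) (hn : 3 ≤ n) (hnodd : Odd n) :
    ∃ C : ℝ, 0 < C ∧
      ∀ (F : Type) [Field F] [Fintype F] [DecidableEq F], ringChar F ≠ 2 →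
      ∀ A : Finset (Fin n → F),
        ((((A ×ˢ A).filter
            (fun p => ∑ i, (p.2 i - p.1 i) * (p.2 i - p.1 i) = 0)).card : ℝ))
          ≤ C * ((Fintype.card F : ℝ)⁻¹ * (A.card : ℝ) ^ 2 +
              (Fintype.card F : ℝ) ^ (((n : ℝ) - 1) / 2) * (A.card : ℝ)) := by
  obtain ⟨m, rfl⟩ := hnodd
  refine ⟨1, one_pos, fun F _ _ _ hF A => ?_⟩
  have hexp : (((2 * m + 1 : ℕ) : ℝ) - 1) / 2 = m := by push_cast; ring
  rw [one_mul, hexp, Real.rpow_natCast]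
  exact FiniteFieldSphere.card_isotropic_pairs_le hF m A
end
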